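/- arXiv:1312.2544 — 4 statements merged into one kernel-verified Lean document; each statement's English description precedes it below -/
import Mathlib

section
/- Define p(t) = 1 − exp(−t), F₂(t) = 1 − exp(−t)·(1 + t), and F₃(t) = 1 − exp(−t)·(1 + t + t²/2). Define the decode-and-forward outage function P_DF(t) = (1 − p(t))²·F₂(t) + (1 − p(t))·p(t)·F₃(t) + p(t)·(1 − p(t))·p(t) + p(t)²·F₂(t). Then the limit as t → 0⁺ of P_DF(t)/t² equals 3/2. -/
open Real Filter Topology

/-- Single-link outage probability `p(t) = 1 - e^{-t}`. -/
noncomputable def singleLinkOutage (t : ℝ) : ℝ := 1 - Real.exp (-t)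

/-- Outage probability after MRC of two equal-SNR copies:
`F₂(t) = 1 - e^{-t}(1 + t)`. -/
noncomputable def mrcOutage2 (t : ℝ) : ℝ := 1 - Real.exp (-t) * (1 + t)

/-- Outage probability after MRC of three equal-SNR copies:
`F₃(t) = 1 - e^{-t}(1 + t + t²/2)`. -/
noncomputable def mrcOutage3 (t : ℝ) : ℝ := 1 - Real.exp (-t) * (1 + t + t ^ 2 / 2)

/-- Decode-and-forward outage function
`P_DF(t) = (1-p)²F₂ + (1-p)pF₃ + p(1-p)p + p²F₂`. -/
noncomputable def dfOutage (t : ℝ) : ℝ :=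
  (1 - singleLinkOutage t) ^ 2 * mrcOutage2 t
    + (1 - singleLinkOutage t) * singleLinkOutage t * mrcOutage3 t
    + singleLinkOutage t * (1 - singleLinkOutage t) * singleLinkOutage t
    + singleLinkOutage t ^ 2 * mrcOutage2 t

/-- The second-order Taylor remainder of `e^{-t}`, divided by `t²`, tends to `1/2` at `0`. -/
lemma tendsto_exp_neg_taylor_two :
    Tendsto (fun t : ℝ => (Real.exp (-t) - 1 + t) / t ^ 2)
      (nhdsWithin 0 (Set.Ioi 0)) (nhds (1 / 2)) := by
  have hlim : Tendsto (fun t : ℝ => t) (nhdsWithin 0 (Set.Ioi 0)) (nhds 0) :=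
    nhdsWithin_le_nhds
  rw [tendsto_iff_norm_sub_tendsto_zero]
  refine squeeze_zero' (Eventually.of_forall fun _ => norm_nonneg _) ?_ hlim
  filter_upwards [Ioo_mem_nhdsGT (zero_lt_one' ℝ)] with t ⟨ht0, ht1⟩
  have hb := Real.exp_bound (x := -t) (by rw [abs_neg, abs_of_pos ht0]; exact ht1.le)
    (n := 3) (by norm_num)
  rw [abs_neg, abs_of_pos ht0] at hb
  norm_num [Finset.sum_range_succ, Nat.factorial] at hb
  have heq : (Real.exp (-t) - 1 + t) / t ^ 2 - 1 / 2
      = (Real.exp (-t) - (1 + -t + t ^ 2 / 2)) / t ^ 2 := by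
    field_simp
    ring
  rw [heq, Real.norm_eq_abs, abs_div, abs_of_pos (pow_pos ht0 2), div_le_iff₀ (pow_pos ht0 2)]
  refine hb.trans ?_
  nlinarith [pow_pos ht0 3]

/-- `lim_{t → 0⁺} P_DF(t)/t² = 3/2`. -/
theorem df_outage_high_snr_limit :
    Tendsto (fun t : ℝ => dfOutage t / t ^ 2)
      (nhdsWithin 0 (Set.Ioi 0)) (nhds (3 / 2)) := by
  have hr := tendsto_exp_neg_taylor_two
  set r : ℝ → ℝ := fun t => (Real.exp (-t) - 1 + t) / t ^ 2 with hr_def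
  have hlim : Tendsto (fun t : ℝ => t) (nhdsWithin 0 (Set.Ioi 0)) (nhds 0) :=
    nhdsWithin_le_nhds
  have he : Tendsto (fun t : ℝ => Real.exp (-t)) (nhdsWithin 0 (Set.Ioi 0)) (nhds 1) := by
    simpa [Function.comp_def] using (Real.continuous_exp.tendsto _).comp hlim.neg
  have hp : Tendsto (fun t : ℝ => 1 - Real.exp (-t)) (nhdsWithin 0 (Set.Ioi 0)) (nhds 0) := by
    simpa using he.const_sub 1
  have hq : Tendsto (fun t : ℝ => 1 - t * r t) (nhdsWithin 0 (Set.Ioi 0)) (nhds 1) := by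
    simpa using (hlim.mul hr).const_sub 1
  have hG : Tendsto (fun t : ℝ => 1 - r t * (1 + t))
      (nhdsWithin 0 (Set.Ioi 0)) (nhds (1 - 1 / 2 * (1 + 0))) :=
    (hr.mul (hlim.const_add 1)).const_sub 1
  have hmain := ((((he.pow 2).mul hG).add ((he.mul hp).mul (hG.sub (he.div_const 2)))).add
    ((hq.pow 2).mul he)).add ((hp.pow 2).mul hG)
  norm_num at hmain
  refine hmain.congr' ?_
  filter_upwards [self_mem_nhdsWithin] with t (ht : 0 < t)
  simp only [hr_def, dfOutage, singleLinkOutage, mrcOutage2, mrcOutage3]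
  field_simp
  ring
end

section
/- Define p(t) = 1 − exp(−t) and F₂(t) = 1 − exp(−t)·(1 + t). Define the network-coded outage function P_NC(t) = (1 − p(t))²·(3p(t)³ − 2p(t)⁴) + p(t)²·F₂(t) + (1 − p(t))·p(t)·(2p(t)³ − p(t)⁴) + p(t)·(1 − p(t))·p(t)². Then the limit as t → 0⁺ of P_NC(t)/t³ equals 4. -/
open Real Filter Topology

/-- Network-coded outage function
`P_NC(t) = (1-p)²(3p³-2p⁴) + p²F₂ + (1-p)p(2p³-p⁴) + p(1-p)p²`. -/
noncomputable def ncOutage (t : ℝ) : ℝ :=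
  (1 - singleLinkOutage t) ^ 2 * (3 * singleLinkOutage t ^ 3 - 2 * singleLinkOutage t ^ 4)
    + singleLinkOutage t ^ 2 * mrcOutage2 t
    + (1 - singleLinkOutage t) * singleLinkOutage t
        * (2 * singleLinkOutage t ^ 3 - singleLinkOutage t ^ 4)
    + singleLinkOutage t * (1 - singleLinkOutage t) * singleLinkOutage t ^ 2

theorem tendsto_singleLinkOutage_div :
    Tendsto (fun t : ℝ => singleLinkOutage t / t) (𝓝[>] 0) (𝓝 1) := by
  have h : HasDerivAt singleLinkOutage 1 0 := by
    have h_exp : HasDerivAt (fun t : ℝ => 1 - Real.exp (-t)) 1 0 := by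
      simpa using ((hasDerivAt_neg (0 : ℝ)).exp).const_sub 1
    exact h_exp
  have h_slope := h.tendsto_slope.mono_left (nhdsGT_le_nhdsNE 0)
  refine h_slope.congr fun t => ?_
  simp [slope_def_field, singleLinkOutage]

theorem tendsto_singleLinkOutage :
    Tendsto singleLinkOutage (𝓝[>] 0) (𝓝 0) := by
  have h : Continuous singleLinkOutage := by
    unfold singleLinkOutage
    fun_prop
  simpa [singleLinkOutage] using (h.tendsto 0).mono_left nhdsWithin_le_nhds

theorem mrcOutage2_eq (t : ℝ) :
    mrcOutage2 t = singleLinkOutage t - t * (1 - singleLinkOutage t) := by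
  unfold mrcOutage2 singleLinkOutage
  ring

/-- `lim_{t → 0⁺} P_NC(t)/t³ = 4`. -/
theorem nc_outage_high_snr_limit :
    Tendsto (fun t : ℝ => ncOutage t / t ^ 3)
      (nhdsWithin 0 (Set.Ioi 0)) (nhds 4) := by
  have hp := tendsto_singleLinkOutage
  have hq := tendsto_singleLinkOutage_div
  have h_one : Tendsto (fun t : ℝ => 1 - singleLinkOutage t) (𝓝[>] 0) (𝓝 (1 - 0)) :=
    hp.const_sub 1
  have h_lim := ((hq.pow 3).mul
    ((((h_one.pow 2).mul ((hp.const_mul 2).const_sub 3)).add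
      (h_one.mul ((hp.const_mul 2).sub (hp.pow 2)))).add h_one)).add
    ((hq.pow 2).mul (hq.sub h_one))
  norm_num at h_lim
  refine h_lim.congr' ?_
  filter_upwards [self_mem_nhdsWithin] with t ht
  have ht0 : t ≠ 0 := ne_of_gt ht
  unfold ncOutage
  rw [mrcOutage2_eq]
  field_simp
  ring
end

section
/- Let R̄ > 0 and define Λ̃(α) = ((1−α)/α)·2^{R̄/(1−α)} for α ∈ (0,1). Let α* = 1/(R̄·ln 2 + 1). Then α* ∈ (0,1) and Λ̃ attains a strict global minimum on (0,1) at α*; that is, for every α ∈ (0,1) with α ≠ α*, Λ̃(α) > Λ̃(α*). -/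
open Real

/-- The high-rate approximation `Λ̃(α) = ((1-α)/α)·2^{R̄/(1-α)}`. -/
noncomputable def LamTilde (R : ℝ) (α : ℝ) : ℝ :=
  ((1 - α) / α) * (2 : ℝ) ^ (R / (1 - α))

/-- In the variable `t = (1 - α) / α`, the function `Λ̃` is `t * exp (c + c / t)` with
`c = R * log 2`. -/
theorem LamTilde_one_div_add_one (R : ℝ) {t : ℝ} (ht : 0 < t) :
    LamTilde R (1 / (t + 1)) = t * Real.exp (R * Real.log 2 + R * Real.log 2 / t) := by
  have h1 : t + 1 ≠ 0 := by positivity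
  have h2 : 1 - 1 / (t + 1) = t / (t + 1) := by field_simp; ring
  rw [LamTilde, h2, Real.rpow_def_of_pos two_pos]
  congr 1
  · field_simp
  · congr 1
    field_simp

/-- The function `t ↦ t * exp (c + c / t)` has a strict minimum on `(0, ∞)` at `c`. -/
theorem mul_exp_add_div_lt {c t : ℝ} (hc : 0 < c) (ht : 0 < t) (h : t ≠ c) :
    c * Real.exp (c + c / c) < t * Real.exp (c + c / t) := by
  have hne : c / t - 1 ≠ 0 := by
    rw [sub_ne_zero, Ne, div_eq_one_iff_eq ht.ne']
    exact h.symm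
  have h1 : c / t < Real.exp (c / t - 1) := by
    simpa using Real.add_one_lt_exp hne
  have h2 : c < t * Real.exp (c / t - 1) := (div_lt_iff₀' ht).mp h1
  have h3 : c + c / t = (c / t - 1) + (c + 1) := by ring
  rw [div_self hc.ne', h3, Real.exp_add (c / t - 1), ← mul_assoc]
  exact mul_lt_mul_of_pos_right h2 (Real.exp_pos _)

/-- Proposition 1, Optimal Time-Sharing: for `R̄ > 0`, the point
`α* = 1/(R̄ ln 2 + 1)` lies in `(0,1)` and is the strict global minimizer of
`Λ̃` on `(0,1)`. -/
theorem optimal_time_sharing (R : ℝ) (hR : 0 < R) :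
    (1 / (R * Real.log 2 + 1)) ∈ Set.Ioo (0 : ℝ) 1 ∧
      ∀ α ∈ Set.Ioo (0 : ℝ) 1, α ≠ 1 / (R * Real.log 2 + 1) →
        LamTilde R (1 / (R * Real.log 2 + 1)) < LamTilde R α := by
  have hc : 0 < R * Real.log 2 := mul_pos hR (Real.log_pos one_lt_two)
  refine ⟨⟨by positivity, ?_⟩, ?_⟩
  · rw [div_lt_one (by positivity)]
    linarith
  · rintro α ⟨h0, h1⟩ hne
    have ht : 0 < 1 / α - 1 := sub_pos.mpr (one_lt_one_div h0 h1)
    have hα : α = 1 / ((1 / α - 1) + 1) := by simp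
    have hne' : 1 / α - 1 ≠ R * Real.log 2 := fun h => hne (h ▸ hα)
    rw [hα, LamTilde_one_div_add_one R hc, LamTilde_one_div_add_one R ht]
    exact mul_exp_add_div_lt hc ht hne'
end

section
/- Let μ > 0, κ > 0, m > 0 be real numbers and k ≥ 1 a natural number. Define P(γ) = μ·( (1/Γ(m))·∫₀^{κ·γ^{−1/2}} t^{m−1}e^{−t} dt )^k for γ > 0, where Γ is the real Gamma function. Then the limit as γ → ∞ of −log P(γ) / log γ equals k·m/2. -/
open Real Filter Topology MeasureTheory

/-- The integral of `t ^ (m - 1)` over `[0, x]` is `x ^ m / m`. -/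
lemma integral_rpow_sub_one {m : ℝ} (hm : 0 < m) (x : ℝ) :
    ∫ t in (0 : ℝ)..x, t ^ (m - 1) = x ^ m / m := by
  rw [integral_rpow (Or.inl (by linarith))]
  simp [Real.zero_rpow hm.ne']

lemma intervalIntegrable_rpow_mul_exp_neg {m : ℝ} (hm : 0 < m) (x : ℝ) :
    IntervalIntegrable (fun t : ℝ => t ^ (m - 1) * Real.exp (-t)) volume 0 x :=
  (intervalIntegral.intervalIntegrable_rpow' (by linarith)).mul_continuousOn (by fun_prop)

lemma lowerGamma_le {m x : ℝ} (hm : 0 < m) (hx : 0 ≤ x) :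
    ∫ t in (0 : ℝ)..x, t ^ (m - 1) * Real.exp (-t) ≤ x ^ m / m := by
  rw [← integral_rpow_sub_one hm]
  refine intervalIntegral.integral_mono_on hx (intervalIntegrable_rpow_mul_exp_neg hm x)
    (intervalIntegral.intervalIntegrable_rpow' (by linarith)) fun t ht => ?_
  exact mul_le_of_le_one_right (Real.rpow_nonneg ht.1 _) (Real.exp_le_one_iff.2 (by linarith [ht.1]))

lemma le_lowerGamma {m x : ℝ} (hm : 0 < m) (hx : 0 ≤ x) :
    x ^ m / m * Real.exp (-x) ≤ ∫ t in (0 : ℝ)..x, t ^ (m - 1) * Real.exp (-t) := by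
  rw [← integral_rpow_sub_one hm, ← intervalIntegral.integral_mul_const]
  refine intervalIntegral.integral_mono_on hx
    ((intervalIntegral.intervalIntegrable_rpow' (by linarith)).mul_const _)
    (intervalIntegrable_rpow_mul_exp_neg hm x) fun t ht => ?_
  exact mul_le_mul_of_nonneg_left (Real.exp_le_exp.2 (by linarith [ht.2]))
    (Real.rpow_nonneg ht.1 _)

lemma lowerGamma_pos {m x : ℝ} (hm : 0 < m) (hx : 0 < x) :
    0 < ∫ t in (0 : ℝ)..x, t ^ (m - 1) * Real.exp (-t) :=
  (by positivity : 0 < x ^ m / m * Real.exp (-x)).trans_le (le_lowerGamma hm hx.le)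

/-- Near zero, the logarithm of the lower incomplete gamma function is `m log x - log m + o(1)`. -/
lemma tendsto_log_lowerGamma_sub {m : ℝ} (hm : 0 < m) :
    Tendsto (fun x : ℝ =>
        Real.log (∫ t in (0 : ℝ)..x, t ^ (m - 1) * Real.exp (-t)) - m * Real.log x)
      (𝓝[>] 0) (𝓝 (-Real.log m)) := by
  have hlog {x : ℝ} (hx : 0 < x) : Real.log (x ^ m / m) = m * Real.log x - Real.log m := by
    rw [Real.log_div (by positivity) hm.ne', Real.log_rpow hx]
  have hlower : Tendsto (fun x : ℝ => -Real.log m - x) (𝓝[>] 0) (𝓝 (-Real.log m)) := by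
    have : Tendsto (fun x : ℝ => -Real.log m - x) (𝓝 0) (𝓝 (-Real.log m - 0)) :=
      (continuous_const.sub continuous_id).tendsto 0
    simpa using this.mono_left nhdsWithin_le_nhds
  refine tendsto_of_tendsto_of_tendsto_of_le_of_le' hlower tendsto_const_nhds ?_ ?_
  · filter_upwards [self_mem_nhdsWithin] with x (hx : 0 < x)
    have h := Real.log_le_log (by positivity) (le_lowerGamma hm hx.le)
    rw [Real.log_mul (by positivity) (by positivity), Real.log_exp, hlog hx] at h
    linarith
  · filter_upwards [self_mem_nhdsWithin] with x (hx : 0 < x)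
    have h := Real.log_le_log (lowerGamma_pos hm hx) (lowerGamma_le hm hx.le)
    rw [hlog hx] at h
    linarith

/-- Proposition 2, Diversity Order: for
`P(γ) = μ·((1/Γ(m))·∫₀^{κ γ^{-1/2}} t^{m-1} e^{-t} dt)^k`, one has
`lim_{γ → ∞} -log P(γ)/log γ = k·m/2`. -/
theorem diversity_order (μ κ m : ℝ) (hμ : 0 < μ) (hκ : 0 < κ) (hm : 0 < m)
    (k : ℕ) (hk : 1 ≤ k) :
    Tendsto
      (fun γ : ℝ =>
        -Real.log (μ * ((1 / Real.Gamma m)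
            * ∫ t in (0 : ℝ)..(κ * γ ^ (-(1 : ℝ) / 2)), t ^ (m - 1) * Real.exp (-t)) ^ k)
          / Real.log γ)
      atTop (nhds (k * m / 2)) := by
  have hx : Tendsto (fun γ : ℝ => κ * γ ^ (-(1 : ℝ) / 2)) atTop (𝓝[>] 0) := by
    refine tendsto_nhdsWithin_iff.2 ⟨?_, ?_⟩
    · have h := (tendsto_rpow_neg_atTop (y := (1 : ℝ) / 2) (by norm_num)).const_mul κ
      simpa [neg_div] using h
    · filter_upwards [eventually_gt_atTop 0] with γ hγ
      exact Set.mem_Ioi.2 (by positivity)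
  have hrem := ((((tendsto_log_lowerGamma_sub hm).comp hx).const_add
    (m * Real.log κ - Real.log (Real.Gamma m))).const_mul (k : ℝ)).const_add (Real.log μ)
  have hlim := (hrem.div_atTop Real.tendsto_log_atTop).const_sub (k * m / 2)
  rw [sub_zero] at hlim
  refine hlim.congr' ?_
  filter_upwards [eventually_gt_atTop 1] with γ hγ
  have hγ0 : 0 < γ := by linarith
  have hI := lowerGamma_pos hm (show 0 < κ * γ ^ (-(1 : ℝ) / 2) by positivity)
  have hΓ := Real.Gamma_pos_of_pos hm
  have hlogγ := Real.log_pos hγ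
  rw [Real.log_mul hμ.ne' (by positivity), Real.log_pow, Real.log_mul (by positivity) hI.ne',
    one_div, Real.log_inv, Function.comp_apply, Real.log_mul hκ.ne' (by positivity),
    Real.log_rpow hγ0]
  field_simp
  ring
end
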